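/- For every integer n ≥ 1 and every j ≥ 0, the number of little Schröder paths of length 2n with exactly j double horizontal steps equals (1/n)·C(n,j)·C(2n−j, n+1), where C denotes the binomial coefficient. -/

import Mathlib

/-- A step of a Schröder path: upstep, downstep, or a *double* horizontal step. -/
inductive SchStep : Type
  | up : SchStep
  | down : SchStep
  | horiz : SchStep
deriving DecidableEq

/-- The number of unit steps a step occupies: `horiz` is a double horizontal step. -/
def SchStep.len : SchStep → ℕ
  | .up => 1
  | .down => 1
  | .horiz => 2

/-- The change in height produced by a step. -/
def SchStep.rise : SchStep → ℤ
  | .up => 1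
  | .down => -1
  | .horiz => 0

/-- The length of a path (a double horizontal step counts 2). -/
def pathLen (p : List SchStep) : ℕ := (p.map SchStep.len).sum

/-- The final height of a path started at height 0. -/
def pathHeight (p : List SchStep) : ℤ := (p.map SchStep.rise).sum

/-- A big Schröder path: ends at height 0 and never goes below the x-axis. -/
def IsBigSchroeder (p : List SchStep) : Prop :=
  pathHeight p = 0 ∧ ∀ q : List SchStep, q <+: p → 0 ≤ pathHeight q

/-- A little Schröder path: a big Schröder path with no double horizontal step at
height 0. -/
def IsLittleSchroeder (p : List SchStep) : Prop :=
  IsBigSchroeder p ∧ ∀ q r : List SchStep, p = q ++ SchStep.horiz :: r → pathHeight q ≠ 0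

/-- `p` is a suffix of a little Schröder path, starting at height `h`. -/
def ValidFrom : ℕ → List SchStep → Prop
  | h, [] => h = 0
  | h, .up :: p => ValidFrom (h + 1) p
  | 0, .down :: _ => False
  | h + 1, .down :: p => ValidFrom h p
  | 0, .horiz :: _ => False
  | h + 1, .horiz :: p => ValidFrom (h + 1) p

/-- The paths from height `h` with `k` steps and `j` double horizontal steps. -/
def paths : ℕ → ℕ → ℕ → Finset (List SchStep)
  | 0, 0, 0 => {[]}
  | 0, _ + 1, _ => ∅
  | 0, 0, _ + 1 => ∅
  | k + 1, 0, j => (paths k 1 j).image (List.cons .up)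
  | k + 1, h + 1, 0 =>
      (paths k (h + 2) 0).image (List.cons .up) ∪ (paths k h 0).image (List.cons .down)
  | k + 1, h + 1, j + 1 =>
      (paths k (h + 2) (j + 1)).image (List.cons .up) ∪
        ((paths k h (j + 1)).image (List.cons .down) ∪
          (paths k (h + 1) j).image (List.cons .horiz))

theorem mem_paths (p : List SchStep) : ∀ k h j, p ∈ paths k h j ↔
    ValidFrom h p ∧ p.length = k ∧ p.count SchStep.horiz = j := by
  induction p with
  | nil =>
    intro k h j
    rcases k with _ | k <;> rcases h with _ | h <;> rcases j with _ | j <;>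
      simp [paths, ValidFrom]
  | cons s p ih =>
    intro k h j
    rcases k with _ | k <;> rcases h with _ | h <;> rcases j with _ | j <;> cases s <;>
      simp [paths, ValidFrom, ih]

theorem card_cons (s : SchStep) (A : Finset (List SchStep)) :
    (A.image (List.cons s)).card = A.card :=
  Finset.card_image_of_injective _ (List.cons_injective)

theorem disj_cons (s t : SchStep) (h : s ≠ t) (A B : Finset (List SchStep)) :
    Disjoint (A.image (List.cons s)) (B.image (List.cons t)) := by
  rw [Finset.disjoint_left]
  intro x hx hy
  simp only [Finset.mem_image] at hx hy
  obtain ⟨a, _, rfl⟩ := hx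
  obtain ⟨b, _, hb⟩ := hy
  simp at hb
  exact h hb.1.symm

theorem card_zero (k j : ℕ) : (paths (k + 1) 0 j).card = (paths k 1 j).card := by
  simp only [paths, card_cons]

theorem card_succ_zero (k h : ℕ) : (paths (k + 1) (h + 1) 0).card =
    (paths k (h + 2) 0).card + (paths k h 0).card := by
  simp only [paths]
  rw [Finset.card_union_of_disjoint (disj_cons _ _ (by simp) _ _), card_cons, card_cons]

theorem card_succ_succ (k h j : ℕ) : (paths (k + 1) (h + 1) (j + 1)).card =
    (paths k (h + 2) (j + 1)).card + ((paths k h (j + 1)).card +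
      (paths k (h + 1) j).card) := by
  simp only [paths]
  rw [Finset.card_union_of_disjoint, Finset.card_union_of_disjoint, card_cons, card_cons,
    card_cons]
  · exact disj_cons _ _ (by simp) _ _
  · rw [Finset.disjoint_union_right]
    exact ⟨disj_cons _ _ (by simp) _ _, disj_cons _ _ (by simp) _ _⟩

/-- If there are too few steps there is no path. -/
theorem card_small : ∀ k h j, k < h + j → (paths k h j).card = 0 := by
  intro k
  induction k with
  | zero =>
    intro h j hk
    rcases h with _ | h <;> rcases j with _ | j <;> simp [paths] at hk ⊢
  | succ k ih =>
    intro h j hk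
    rcases h with _ | h
    · rw [card_zero, ih]; omega
    · rcases j with _ | j
      · rw [card_succ_zero, ih, ih] <;> omega
      · rw [card_succ_succ, ih, ih, ih] <;> omega

/-- closed form -/
def F : ℕ → ℕ → ℕ → ℤ
  | 0, h, j => ((h + j - 1).choose j : ℤ)
  | u + 1, h, j => ((2 * u + 2 + h + j).choose (u + 1) : ℤ) * ((u + h + j).choose j : ℤ)
      - ((2 * u + 2 + h + j).choose u : ℤ) * ((u + 1 + h + j).choose j : ℤ)

theorem bdry (u j : ℕ) : (2 * u + 1 + j).choose (u + 1) * (u + j).choose j =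
    (2 * u + 1 + j).choose u * (u + 1 + j).choose j := by
  have h1 := Nat.choose_mul_succ_eq (u + j) j
  have h2 := Nat.choose_succ_right_eq (2 * u + 1 + j) u
  rw [show u + j + 1 - j = u + 1 by omega] at h1
  rw [show 2 * u + 1 + j - u = u + j + 1 by omega] at h2
  rw [show u + 1 + j = u + j + 1 by omega]
  apply Nat.eq_of_mul_eq_mul_right (show 0 < u + 1 by omega)
  calc _ = ((2 * u + 1 + j).choose (u + 1) * (u + 1)) * (u + j).choose j := by ring
    _ = (2 * u + 1 + j).choose u * ((u + j).choose j * (u + j + 1)) := by rw [h2]; ring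
    _ = _ := by rw [h1]; ring

theorem F_zero (u j : ℕ) : F (u + 1) 0 j = F u 1 j := by
  have hb := bdry u j
  zify at hb
  rcases u with _ | u
  · simp only [F]
    rw [show 2 * 0 + 2 + 0 + j = j + 1 + 1 by omega, show 0 + 0 + j = j by omega,
      show 1 + j - 1 = j by omega, show 0 + 1 + 0 + j = j + 1 by omega]
    simp [Nat.choose_one_right]
  · simp only [F]
    rw [show 2 * (u + 1) + 2 + 0 + j = (2 * u + 3 + j) + 1 by omega,
      show 2 * u + 2 + 1 + j = 2 * u + 3 + j by omega,
      Nat.choose_succ_succ' _ (u + 1), Nat.choose_succ_succ' _ u]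
    rw [show 2 * (u + 1) + 1 + j = 2 * u + 3 + j by omega] at hb
    simp only [add_zero, Nat.add_right_comm] at hb ⊢
    push_cast at hb ⊢
    ring_nf at hb ⊢
    linarith

theorem F_succ_zero (u h : ℕ) : F (u + 1) (h + 1) 0 = F u (h + 2) 0 + F (u + 1) h 0 := by
  rcases u with _ | u
  · simp [F]
    ring
  · simp only [F, Nat.choose_zero_right, add_zero]
    rw [show 2 * (u + 1) + 2 + (h + 1) = (2 * u + 4 + h) + 1 by omega,
      show 2 * u + 2 + (h + 2) = 2 * u + 4 + h by omega,
      show 2 * (u + 1) + 2 + h = 2 * u + 4 + h by omega,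
      Nat.choose_succ_succ' _ (u + 1), Nat.choose_succ_succ' _ u]
    push_cast
    ring

theorem F_succ_succ (u h j : ℕ) : F (u + 1) (h + 1) (j + 1) =
    F u (h + 2) (j + 1) + (F (u + 1) h (j + 1) + F (u + 1) (h + 1) j) := by
  rcases u with _ | u
  · simp only [F]
    rw [show 2 * 0 + 2 + (h + 1) + (j + 1) = h + j + 3 + 1 by omega,
      show 2 * 0 + 2 + h + (j + 1) = h + j + 3 by omega,
      show 2 * 0 + 2 + (h + 1) + j = h + j + 3 by omega,
      show 0 + (h + 1) + (j + 1) = h + j + 1 + 1 by omega,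
      show 0 + 1 + (h + 1) + (j + 1) = h + j + 2 + 1 by omega,
      show h + 2 + (j + 1) - 1 = h + j + 1 + 1 by omega,
      show 0 + h + (j + 1) = h + j + 1 by omega,
      show 0 + (h + 1) + j = h + j + 1 by omega,
      show 0 + 1 + h + (j + 1) = h + j + 1 + 1 by omega,
      show 0 + 1 + (h + 1) + j = h + j + 1 + 1 by omega,
      show h + j + 2 + 1 = h + j + 1 + 1 + 1 by omega,
      Nat.choose_succ_succ' (h + j + 1 + 1) j,
      Nat.choose_succ_succ' (h + j + 1) j]
    simp
    ring
  · simp only [F]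
    rw [show 2 * (u + 1) + 2 + (h + 1) + (j + 1) = 2 * u + h + j + 5 + 1 by omega,
      show 2 * (u + 1) + 2 + h + (j + 1) = 2 * u + h + j + 5 by omega,
      show 2 * (u + 1) + 2 + (h + 1) + j = 2 * u + h + j + 5 by omega,
      show 2 * u + 2 + (h + 2) + (j + 1) = 2 * u + h + j + 5 by omega,
      show u + 1 + (h + 1) + (j + 1) = u + h + j + 2 + 1 by omega,
      show u + 1 + 1 + (h + 1) + (j + 1) = u + h + j + 3 + 1 by omega,
      show u + (h + 2) + (j + 1) = u + h + j + 2 + 1 by omega,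
      show u + 1 + (h + 2) + (j + 1) = u + h + j + 3 + 1 by omega,
      show u + 1 + h + (j + 1) = u + h + j + 2 by omega,
      show u + 1 + 1 + h + (j + 1) = u + h + j + 3 by omega,
      show u + 1 + (h + 1) + j = u + h + j + 2 by omega,
      show u + 1 + 1 + (h + 1) + j = u + h + j + 3 by omega,
      Nat.choose_succ_succ' (2 * u + h + j + 5) (u + 1),
      Nat.choose_succ_succ' (2 * u + h + j + 5) u,
      Nat.choose_succ_succ' (u + h + j + 2) j,
      Nat.choose_succ_succ' (u + h + j + 3) j]
    have hp : (((u + h + j + 3).choose (j + 1) : ℕ) : ℤ) =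
        ((u + h + j + 2).choose j : ℕ) + ((u + h + j + 2).choose (j + 1) : ℕ) := by
      exact_mod_cast Nat.choose_succ_succ' (u + h + j + 2) j
    push_cast
    linear_combination (-(((2 * u + h + j + 5).choose (u + 1) : ℕ) : ℤ)) * hp

theorem card_paths : ∀ k u h j, k = 2 * u + h + j → ((paths k h j).card : ℤ) = F u h j := by
  intro k
  induction k with
  | zero =>
    intro u h j hk
    obtain rfl : u = 0 := by omega
    obtain rfl : h = 0 := by omega
    obtain rfl : j = 0 := by omega
    simp [paths, F]
  | succ k ih =>
    intro u h j hk
    rcases h with _ | h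
    · rw [card_zero]
      rcases u with _ | u
      · rw [card_small _ _ _ (by omega)]
        obtain rfl : j = k + 1 := by omega
        simp [F]
      · rw [ih u 1 j (by omega), F_zero]
    · rcases j with _ | j
      · rw [card_succ_zero]
        push_cast
        rcases u with _ | u
        · rw [card_small _ _ _ (by omega), ih 0 h 0 (by omega)]
          simp [F]
        · rw [ih u _ _ (by omega), ih (u + 1) h 0 (by omega), F_succ_zero]
      · rw [card_succ_succ]
        push_cast
        rcases u with _ | u
        · rw [card_small _ _ _ (by omega), ih 0 h _ (by omega), ih 0 (h + 1) j (by omega)]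
          simp only [F]
          rw [show h + 1 + (j + 1) - 1 = h + j + 1 by omega, Nat.choose_succ_succ',
            show h + (j + 1) - 1 = h + j by omega, show h + 1 + j - 1 = h + j by omega]
          push_cast
          ring
        · rw [ih u _ _ (by omega), ih (u + 1) h _ (by omega), ih (u + 1) (h + 1) _ (by omega),
            F_succ_succ]

theorem pathHeight_cons (s : SchStep) (p : List SchStep) :
    pathHeight (s :: p) = s.rise + pathHeight p := by
  simp [pathHeight]

theorem pathHeight_nil : pathHeight [] = 0 := by
  simp [pathHeight]

theorem prefix_cons_forall (s : SchStep) (p : List SchStep) (P : List SchStep → Prop) :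
    (∀ q, q <+: s :: p → P q) ↔ P [] ∧ ∀ q, q <+: p → P (s :: q) := by
  constructor
  · intro h
    exact ⟨h _ (by simp), fun q hq => h _ (by simpa using hq)⟩
  · rintro ⟨h0, h1⟩ q hq
    rcases q with _ | ⟨t, q⟩
    · exact h0
    · rw [List.cons_prefix_cons] at hq
      obtain ⟨rfl, hq⟩ := hq
      exact h1 q hq

theorem split_cons_forall (s : SchStep) (p : List SchStep) (P : List SchStep → Prop) :
    (∀ q r, s :: p = q ++ SchStep.horiz :: r → P q) ↔
      (s = SchStep.horiz → P []) ∧ ∀ q r, p = q ++ SchStep.horiz :: r → P (s :: q) := by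
  constructor
  · intro h
    exact ⟨fun hs => h [] p (by simp [hs]), fun q r hq => h (s :: q) r (by simp [hq])⟩
  · rintro ⟨h0, h1⟩ q r hq
    rcases q with _ | ⟨t, q⟩
    · simp at hq
      exact h0 hq.1
    · simp at hq
      obtain ⟨rfl, hq⟩ := hq
      exact h1 q r hq

theorem validFrom_iff (p : List SchStep) : ∀ h : ℕ, ValidFrom h p ↔
    (((h : ℤ) + pathHeight p = 0 ∧ ∀ q : List SchStep, q <+: p → 0 ≤ (h : ℤ) + pathHeight q) ∧
      ∀ q r : List SchStep, p = q ++ SchStep.horiz :: r → (h : ℤ) + pathHeight q ≠ 0) := by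
  induction p with
  | nil =>
    intro h
    simp only [ValidFrom, pathHeight_nil, List.prefix_nil, forall_eq]
    simp
  | cons s p ih =>
    intro h
    rw [prefix_cons_forall s p (fun q => 0 ≤ (h : ℤ) + pathHeight q),
      split_cons_forall s p (fun q => (h : ℤ) + pathHeight q ≠ 0)]
    simp only [pathHeight_cons, pathHeight_nil]
    cases s
    · simp [ValidFrom, ih, SchStep.rise, add_assoc]
    · rcases h with _ | h
      · simp only [ValidFrom, SchStep.rise, false_iff]
        rintro ⟨⟨-, -, h⟩, -⟩
        have := h [] (by simp)
        simp [pathHeight_nil] at this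
      · have e : ∀ x : ℤ, ((h + 1 : ℕ) : ℤ) + (-1 + x) = h + x := by
          intro x; push_cast; ring
        simp only [ValidFrom, ih, SchStep.rise, e]
        have : (0 : ℤ) ≤ ((h + 1 : ℕ) : ℤ) + 0 := by positivity
        simp only [this, true_and, reduceCtorEq, false_imp_iff]
    · rcases h with _ | h
      · simp [ValidFrom]
      · simp only [ValidFrom, ih, SchStep.rise, zero_add]
        have h1 : (0 : ℤ) ≤ ((h + 1 : ℕ) : ℤ) + 0 := by positivity
        have h2 : ((h + 1 : ℕ) : ℤ) + 0 ≠ 0 := by positivity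
        simp only [h1, h2, true_and, ne_eq, not_false_eq_true, implies_true]

theorem little_iff (p : List SchStep) : IsLittleSchroeder p ↔ ValidFrom 0 p := by
  rw [validFrom_iff]
  simp [IsLittleSchroeder, IsBigSchroeder]

theorem pathLen_eq (p : List SchStep) :
    pathLen p = p.length + p.count SchStep.horiz := by
  induction p with
  | nil => simp [pathLen]
  | cons s p ih =>
    have : pathLen (s :: p) = s.len + pathLen p := by simp [pathLen]
    rw [this, ih]
    cases s <;> simp [SchStep.len] <;> omega

/-- The number of little Schröder paths of length `2n` with exactly `j` double
horizontal steps is `(1/n) C(n,j) C(2n-j, n+1)`. -/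
theorem little_schroeder_horiz_count (n j : ℕ) (hn : 1 ≤ n) :
    (Nat.card {p : List SchStep //
        IsLittleSchroeder p ∧ pathLen p = 2 * n ∧ p.count SchStep.horiz = j} : ℚ) =
      (1 / (n : ℚ)) * (n.choose j) * ((2 * n - j).choose (n + 1)) := by
  have hset : Nat.card {p : List SchStep //
      IsLittleSchroeder p ∧ pathLen p = 2 * n ∧ p.count SchStep.horiz = j} =
      if j ≤ n then (paths (2 * n - j) 0 j).card else 0 := by
    split_ifs with hj
    · rw [← Nat.card_eq_finsetCard]
      refine Nat.card_congr (Equiv.subtypeEquivRight fun p => ?_)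
      rw [mem_paths, little_iff, pathLen_eq]
      constructor
      · rintro ⟨h1, h2, h3⟩
        exact ⟨h1, by omega, h3⟩
      · rintro ⟨h1, h2, h3⟩
        exact ⟨h1, by omega, h3⟩
    · rw [Nat.card_eq_zero]
      left
      refine ⟨fun ⟨p, _, h2, h3⟩ => ?_⟩
      have := pathLen_eq p
      have := List.count_le_length (a := SchStep.horiz) (l := p)
      omega
  rw [hset]
  split_ifs with hj
  · obtain ⟨u, rfl⟩ := Nat.exists_eq_add_of_le hj
    have hc := card_paths (2 * (j + u) - j) u 0 j (by omega)
    have hc' : ((paths (2 * (j + u) - j) 0 j).card : ℚ) = (F u 0 j : ℚ) := by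
      rw [← hc]; simp
    rw [hc']
    rcases u with _ | u
    · simp only [F]
      rw [Nat.choose_eq_zero_of_lt (by omega), Nat.choose_eq_zero_of_lt (n := 2 * (j + 0) - j) (by omega)]
      simp
    · simp only [F]
      have e1 := Nat.choose_mul_succ_eq (u + j) j
      rw [show u + j + 1 - j = u + 1 by omega] at e1
      have e2 := Nat.choose_succ_right_eq (2 * u + 2 + j) u
      rw [show 2 * u + 2 + j - u = u + j + 2 by omega] at e2
      have e3 : (2 * (j + (u + 1)) - j).choose (j + (u + 1) + 1) = (2 * u + 2 + j).choose u := by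
        rw [show 2 * (j + (u + 1)) - j = 2 * u + 2 + j by omega]
        exact Nat.choose_symm_of_eq_add (by omega)
      rw [e3]
      rw [show 2 * u + 2 + 0 + j = 2 * u + 2 + j by omega, show u + 0 + j = u + j by omega,
        show u + 1 + 0 + j = u + j + 1 by omega, show j + (u + 1) = u + j + 1 by omega]
      have q1 : (((u + j).choose j : ℕ) : ℚ) * (u + j + 1) = ((u + j + 1).choose j : ℕ) * (u + 1) := by
        exact_mod_cast e1
      have q2 : (((2 * u + 2 + j).choose (u + 1) : ℕ) : ℚ) * (u + 1) =
          ((2 * u + 2 + j).choose u : ℕ) * (u + j + 2) := by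
        exact_mod_cast e2
      push_cast
      generalize (((u + j).choose j : ℕ) : ℚ) = a at *
      generalize (((u + j + 1).choose j : ℕ) : ℚ) = b at *
      generalize (((2 * u + 2 + j).choose (u + 1) : ℕ) : ℚ) = c at *
      generalize (((2 * u + 2 + j).choose u : ℕ) : ℚ) = d at *
      have hp : (u : ℚ) + j + 1 ≠ 0 := by positivity
      field_simp
      linear_combination c * q1 + b * q2
  · rw [Nat.choose_eq_zero_of_lt (by omega)]
    simp
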